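/- Let d ≥ 1, ρ > 0 and γ ≠ 1 with 0 ≤ γ < max{1 + 1/d, 1 + ρ/(2d)}, and let p be a minimiser for χ^{DB}_γ(ρ) (i.e. p realises the infimum and the infimum is finite). Then the support of p is finite if and only if γ ≤ 1/2; moreover, in the case γ > 1/2 one has p(z) > 0 for every z ∈ ℤ^d. -/

import Mathlib

open MeasureTheory Filter
open scoped ENNReal NNReal Topology

/-- The lattice `ℤ^d`. -/
abbrev Zd (d : ℕ) := Fin d → ℤ

/-- Real power with the convention `0 ^ 0 = 0`. -/
noncomputable def mpow (x γ : ℝ) : ℝ := if x = 0 then 0 else x ^ γ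

/-- `p` is a probability measure on `ℤ^d`, identified with its mass function. -/
def IsProb {d : ℕ} (p : Zd d → ℝ) : Prop := (∀ z, 0 ≤ p z) ∧ HasSum p 1

/-- The discrete Dirichlet form `S(p) = -(Δ√p, √p)`, with values in `[0,∞]`. -/
noncomputable def dirS {d : ℕ} (p : Zd d → ℝ) : ℝ≥0∞ :=
  2⁻¹ * ∑' z : Zd d, ∑' x : Zd d,
    if (∑ i, |x i - z i|) = 1 then
      ENNReal.ofReal ((Real.sqrt (p x) - Real.sqrt (p z)) ^ 2) else 0

/-- The functional whose infimum is `χ^{DB}_γ(ρ)`. -/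
noncomputable def FDB {d : ℕ} (γ ρ : ℝ) (p : Zd d → ℝ) : ℝ≥0∞ :=
  dirS p + ∑' z : Zd d, ENNReal.ofReal (ρ / (1 - γ) * (mpow (p z) γ - p z))

noncomputable def chiDB (d : ℕ) (γ ρ : ℝ) : ℝ≥0∞ :=
  ⨅ p : {p : Zd d → ℝ // IsProb p}, FDB γ ρ p.1

/-- The functional whose infimum is `χ^{DE}(ρ)`. -/
noncomputable def FDE {d : ℕ} (ρ : ℝ) (p : Zd d → ℝ) : ℝ≥0∞ :=
  dirS p + ∑' z : Zd d, ENNReal.ofReal (-(ρ * (p z * Real.log (p z))))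

noncomputable def chiDE (d : ℕ) (ρ : ℝ) : ℝ≥0∞ :=
  ⨅ p : {p : Zd d → ℝ // IsProb p}, FDE ρ p.1

/-- Admissible test functions: smooth, compactly supported, `L²`-normalised. -/
def TestFun (d : ℕ) (g : EuclideanSpace ℝ (Fin d) → ℝ) : Prop :=
  ContDiff ℝ (⊤ : ℕ∞) g ∧ HasCompactSupport g ∧ ∫ x, (g x) ^ 2 = 1

noncomputable def chiAB (d : ℕ) (ρ : ℝ) : ℝ :=
  sInf {v : ℝ | ∃ g : EuclideanSpace ℝ (Fin d) → ℝ, TestFun d g ∧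
    v = ∫ x, ‖fderiv ℝ g x‖ ^ 2 - ρ * ∫ x, (g x) ^ 2 * Real.log ((g x) ^ 2)}

noncomputable def chiB (d : ℕ) (γ ρ : ℝ) : ℝ :=
  sInf {v : ℝ | ∃ g : EuclideanSpace ℝ (Fin d) → ℝ, TestFun d g ∧
    v = ∫ x, ‖fderiv ℝ g x‖ ^ 2 + ρ / (1 - γ) * ∫ x, (mpow ((g x) ^ 2) γ - (g x) ^ 2)}

noncomputable def chiRWRS (d : ℕ) (H : ℝ → ℝ) (θ : ℝ) : ℝ :=
  sInf {v : ℝ | ∃ g : EuclideanSpace ℝ (Fin d) → ℝ, TestFun d g ∧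
    v = ∫ x, ‖fderiv ℝ g x‖ ^ 2 - θ * ∫ x, H ((g x) ^ 2)}

/-- `f` is regularly varying (at infinity) with index `idx`. -/
def RegVary (f : ℝ → ℝ) (idx : ℝ) : Prop :=
  ∀ y : ℝ, 0 < y → Tendsto (fun t => f (t * y) / f t) atTop (𝓝 (y ^ idx))

noncomputable def hatH (γ y : ℝ) : ℝ :=
  if γ = 1 then y * Real.log y else (y - mpow y γ) / (1 - γ)

/-- Assumption (H) of the paper. -/
structure AssumptionH (H : ℝ → ℝ) (γ ρ : ℝ) (khat : ℝ → ℝ) : Prop where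
  hγ : 0 ≤ γ
  hρ : 0 < ρ
  khat_pos : ∀ t, 0 < t → 0 < khat t
  khat_cont : ContinuousOn khat (Set.Ioi 0)
  khat_rv : RegVary khat γ
  conv : ∀ K : Set ℝ, IsCompact K → K ⊆ Set.Ici 0 →
    TendstoUniformlyOn (fun t y => (H (t * y) - y * H t) / khat t)
      (fun y => ρ * hatH γ y) atTop K

/-- The discrete Laplacian on `ℤ^d`. -/
noncomputable def discLap {d : ℕ} (f : Zd d → ℝ) (z : Zd d) : ℝ :=
  ∑ i : Fin d,
    ((f (fun j => z j + if j = i then 1 else 0) - f z) +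
     (f (fun j => z j - if j = i then 1 else 0) - f z))

/-- `u` is a nonnegative solution of the PAM equation with diffusion constant `κt`,
potential `ξ` and localised initial condition. -/
def IsSolPAM {d : ℕ} (κt : ℝ) (ξ : Zd d → ℝ) (u : ℝ → Zd d → ℝ) : Prop :=
  (∀ s z, 0 ≤ u s z) ∧
  (∀ z, u 0 z = if z = 0 then 1 else 0) ∧
  (∀ s, 0 < s → ∀ z,
    HasDerivAt (fun s' => u s' z) (κt * discLap (fun x => u s x) z + ξ z * u s z) s)

/-- `u` is the minimal nonnegative solution. -/
def MinimalSol {d : ℕ} (κt : ℝ) (ξ : Zd d → ℝ) (u : ℝ → Zd d → ℝ) : Prop :=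
  IsSolPAM κt ξ u ∧ ∀ v, IsSolPAM κt ξ v → ∀ s z, u s z ≤ v s z

open Function Asymptotics

section LatticeEnergy

variable {d : ℕ}

theorem ENNReal.tsum_tsum_eq_of_symm {α : Type*} [DecidableEq α] (W : α → α → ℝ≥0∞)
    (hsymm : ∀ z x, W z x = W x z) (hdiag : ∀ z, W z z = 0) (z₀ : α) :
    ∑' z, ∑' x, W z x = 2 * ∑' x, W z₀ x +
      ∑' z, ∑' x, (if z = z₀ ∨ x = z₀ then 0 else W z x) := by
  have key : ∀ z x, W z x = ((if z = z₀ then W z₀ x else 0) + (if x = z₀ then W z₀ z else 0)) +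
      (if z = z₀ ∨ x = z₀ then 0 else W z x) := by
    intro z x
    by_cases h1 : z = z₀
    · subst h1
      by_cases h2 : x = z
      · subst h2; simp [hdiag]
      · simp [h2]
    · by_cases h2 : x = z₀
      · subst h2; simp [h1, hsymm z x]
      · simp [h1, h2]
  have h1 : ∑' z, ∑' x, (if z = z₀ then W z₀ x else 0) = ∑' x, W z₀ x := by
    rw [tsum_eq_single z₀]
    · simp
    · intro z hz; simp [hz]
  have h2 : ∑' z, ∑' x, (if x = z₀ then W z₀ z else 0) = ∑' x, W z₀ x := by
    congr 1; ext z; exact tsum_ite_eq z₀ _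
  calc ∑' z, ∑' x, W z x
      = ∑' z, ∑' x, (((if z = z₀ then W z₀ x else 0) + (if x = z₀ then W z₀ z else 0)) +
        (if z = z₀ ∨ x = z₀ then 0 else W z x)) := by
        congr 1; ext z; congr 1; ext x; exact key z x
    _ = _ := by
        simp_rw [ENNReal.tsum_add]
        rw [h1, h2, two_mul]

theorem finite_l1_unit_sphere (d : ℕ) : {e : Zd d | ∑ i, |e i| = 1}.Finite := by
  refine (Set.finite_Icc (fun _ => -1 : Zd d) (fun _ => 1)).subset ?_
  intro e he
  have h : ∀ i, |e i| ≤ 1 := fun i => by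
    rw [← (show ∑ i, |e i| = 1 from he)]
    exact Finset.single_le_sum (f := fun i => |e i|) (fun j _ => abs_nonneg _) (Finset.mem_univ i)
  exact ⟨fun i => (abs_le.1 (h i)).1, fun i => (abs_le.1 (h i)).2⟩

/-- The unit steps of the lattice. -/
noncomputable def unitSteps (d : ℕ) : Finset (Zd d) := (finite_l1_unit_sphere d).toFinset

theorem mem_unitSteps {e : Zd d} : e ∈ unitSteps d ↔ ∑ i, |e i| = 1 := by
  simp [unitSteps]

/-- The part of the Dirichlet form carried by the edges at `z₀`. -/
noncomputable def siteEnergy (p : Zd d → ℝ) (z₀ : Zd d) : ℝ :=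
  ∑ e ∈ unitSteps d, (√(p (z₀ + e)) - √(p z₀)) ^ 2

theorem tsum_neighbours_eq (p : Zd d → ℝ) (z : Zd d) :
    (∑' x : Zd d, if (∑ i, |x i - z i|) = 1 then
      ENNReal.ofReal ((√(p x) - √(p z)) ^ 2) else 0) = ENNReal.ofReal (siteEnergy p z) := by
  rw [← (Equiv.addLeft z).tsum_eq, siteEnergy,
    ENNReal.ofReal_sum_of_nonneg (fun _ _ => sq_nonneg _), tsum_eq_sum (s := unitSteps d)]
  · refine Finset.sum_congr rfl fun e he => ?_
    rw [mem_unitSteps] at he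
    simp [he]
  · intro e he
    rw [mem_unitSteps] at he
    simp [he]

theorem exists_dirS_eq (z₀ : Zd d) : ∃ R : (Zd d → ℝ) → ℝ≥0∞,
    (∀ p, dirS p = ENNReal.ofReal (siteEnergy p z₀) + R p) ∧
    ∀ p s, R (update p z₀ s) = R p := by
  refine ⟨fun p => 2⁻¹ * ∑' z : Zd d, ∑' x : Zd d, if z = z₀ ∨ x = z₀ then 0 else
    if (∑ i, |x i - z i|) = 1 then ENNReal.ofReal ((√(p x) - √(p z)) ^ 2) else 0, ?_, ?_⟩
  · intro p
    rw [dirS, ENNReal.tsum_tsum_eq_of_symm _ _ _ z₀, tsum_neighbours_eq, mul_add, ← mul_assoc,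
      ENNReal.inv_mul_cancel (by simp) (by simp), one_mul]
    · intro z x
      simp_rw [abs_sub_comm (x _) (z _), ← neg_sub (√(p x)) (√(p z)), neg_sq]
    · intro z; simp
  · intro p s
    dsimp only
    congr 1
    refine tsum_congr fun z => tsum_congr fun x => ?_
    by_cases h : z = z₀ ∨ x = z₀
    · simp [h]
    · rw [not_or] at h
      simp [h.1, h.2]

/-- The potential term of the functional `FDB` at a single site. -/
noncomputable def sitePot (γ ρ x : ℝ) : ℝ := ρ / (1 - γ) * (mpow x γ - x)

@[simp] theorem sitePot_zero (γ ρ : ℝ) : sitePot γ ρ 0 = 0 := by simp [sitePot, mpow]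

theorem sitePot_nonneg {γ ρ x : ℝ} (hρ : 0 < ρ) (hx0 : 0 ≤ x) (hx1 : x ≤ 1) :
    0 ≤ sitePot γ ρ x := by
  rcases hx0.eq_or_lt with rfl | hx
  · simp
  rw [sitePot, mpow, if_neg hx.ne']
  rcases le_total γ 1 with h | h
  · refine mul_nonneg (div_nonneg hρ.le (by linarith)) (sub_nonneg.2 ?_)
    simpa using Real.rpow_le_rpow_of_exponent_ge hx hx1 h
  · refine mul_nonneg_of_nonpos_of_nonpos
      (div_nonpos_of_nonneg_of_nonpos hρ.le (by linarith)) (sub_nonpos.2 ?_)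
    simpa using Real.rpow_le_rpow_of_exponent_ge hx hx1 h

theorem exists_FDB_eq (γ ρ : ℝ) (z₀ : Zd d) : ∃ R : (Zd d → ℝ) → ℝ≥0∞,
    (∀ p, FDB γ ρ p = ENNReal.ofReal (siteEnergy p z₀) +
      ENNReal.ofReal (sitePot γ ρ (p z₀)) + R p) ∧
    ∀ p s, R (update p z₀ s) = R p := by
  obtain ⟨R, hR, hRu⟩ := exists_dirS_eq z₀
  refine ⟨fun p => R p + ∑' z, if z = z₀ then 0 else
    ENNReal.ofReal (sitePot γ ρ (p z)), ?_, ?_⟩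
  · intro p
    have h := ENNReal.tsum_eq_add_tsum_ite
      (f := fun z => ENNReal.ofReal (sitePot γ ρ (p z))) z₀
    calc FDB γ ρ p = dirS p + ∑' z, ENNReal.ofReal (sitePot γ ρ (p z)) := rfl
      _ = _ := by rw [h, hR, add_add_add_comm]; congr!
  · intro p s
    dsimp only
    rw [hRu]
    congr 1
    refine tsum_congr fun z => ?_
    by_cases h : z = z₀ <;> simp [h]

theorem siteEnergy_nonneg (p : Zd d → ℝ) (z : Zd d) : 0 ≤ siteEnergy p z :=
  Finset.sum_nonneg fun _ _ => sq_nonneg _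

theorem siteEnergy_update {p : Zd d → ℝ} (hp : ∀ z, 0 ≤ p z) (z : Zd d) {s : ℝ} (hs : 0 ≤ s) :
    siteEnergy (update p z s) z = siteEnergy p z + (unitSteps d).card * (s - p z) -
      2 * (√s - √(p z)) * ∑ e ∈ unitSteps d, √(p (z + e)) := by
  rw [siteEnergy, siteEnergy, ← nsmul_eq_mul, ← Finset.sum_const, Finset.mul_sum,
    ← Finset.sum_add_distrib, ← Finset.sum_sub_distrib]
  refine Finset.sum_congr rfl fun e he => ?_
  have hne : z + e ≠ z := by
    rintro h
    rw [add_eq_left] at h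
    rw [mem_unitSteps, h] at he
    simp at he
  rw [update_of_ne hne, update_self]
  linear_combination Real.sq_sqrt hs - Real.sq_sqrt (hp z)

theorem FDB_update {γ ρ : ℝ} (hρ : 0 < ρ) {p : Zd d → ℝ} (hp0 : ∀ z, 0 ≤ p z)
    (hp1 : ∀ z, p z ≤ 1) (hfin : FDB γ ρ p ≠ ⊤) (z : Zd d) {s : ℝ} (hs0 : 0 ≤ s) (hs1 : s ≤ 1) :
    FDB γ ρ (update p z s) ≠ ⊤ ∧
    (FDB γ ρ (update p z s)).toReal = (FDB γ ρ p).toReal + (unitSteps d).card * (s - p z) -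
      2 * (√s - √(p z)) * (∑ e ∈ unitSteps d, √(p (z + e))) +
      (sitePot γ ρ s - sitePot γ ρ (p z)) := by
  obtain ⟨R, hR, hRu⟩ := exists_FDB_eq γ ρ z
  have hRfin : R p ≠ ⊤ := by
    intro h
    rw [hR, h] at hfin
    simp at hfin
  rw [hR (update p z s), hR p, hRu, update_self]
  refine ⟨by simp [hRfin], ?_⟩
  rw [ENNReal.toReal_add (by simp) hRfin, ENNReal.toReal_add (by simp) (by simp),
    ENNReal.toReal_add (by simp) hRfin, ENNReal.toReal_add (by simp) (by simp),
    ENNReal.toReal_ofReal (siteEnergy_nonneg _ _), ENNReal.toReal_ofReal (siteEnergy_nonneg _ _),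
    ENNReal.toReal_ofReal (sitePot_nonneg hρ hs0 hs1),
    ENNReal.toReal_ofReal (sitePot_nonneg hρ (hp0 z) (hp1 z)), siteEnergy_update hp0 z hs0]
  ring

theorem IsProb.le_one {p : Zd d → ℝ} (hp : IsProb p) (z : Zd d) : p z ≤ 1 :=
  le_hasSum hp.2 z fun _ _ => hp.1 _

theorem IsProb.exists_pos {p : Zd d → ℝ} (hp : IsProb p) : ∃ z, 0 < p z := by
  by_contra! h
  have h0 : p = 0 := funext fun z => le_antisymm (h z) (hp.1 z)
  have h1 := hp.2
  rw [h0] at h1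
  exact one_ne_zero (h1.unique hasSum_zero)

theorem IsProb.transfer {p : Zd d → ℝ} (hp : IsProb p) {z x : Zd d} (hzx : z ≠ x) {s t : ℝ}
    (hs : 0 ≤ s) (ht : 0 ≤ t) (hst : s + t = p z + p x) :
    IsProb (update (update p z s) x t) := by
  refine ⟨fun w => ?_, ?_⟩
  · by_cases hx : w = x
    · subst hx; simpa
    · by_cases hz : w = z
      · subst hz; simpa [hx]
      · simpa [hx, hz] using hp.1 w
  · have := (hp.2.update z s).update x t
    rw [update_of_ne hzx.symm] at this
    rwa [show t - p x + (s - p z + 1) = 1 by linarith] at this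

/-- Change of `FDB` when mass is transferred between two sites, at a minimiser. -/
theorem transfer_nonneg {γ ρ : ℝ} (hρ : 0 < ρ) {p : Zd d → ℝ} (hp : IsProb p)
    (hmin : FDB γ ρ p = chiDB d γ ρ) (hfin : chiDB d γ ρ ≠ ⊤)
    {z x : Zd d} (hzx : z ≠ x) {s t : ℝ}
    (hs : 0 ≤ s) (ht : 0 ≤ t) (hst : s + t = p z + p x) :
    0 ≤ - 2 * (√s - √(p z)) * (∑ e ∈ unitSteps d, √(p (z + e))) +
      (sitePot γ ρ s - sitePot γ ρ (p z)) -
      2 * (√t - √(p x)) * (∑ e ∈ unitSteps d, √(update p z s (x + e))) +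
      (sitePot γ ρ t - sitePot γ ρ (p x)) := by
  have hq := hp.transfer hzx hs ht hst
  have ht1 : t ≤ 1 := by simpa using hq.le_one x
  have hs1 : s ≤ 1 := by simpa [hzx] using hq.le_one z
  have hpfin : FDB γ ρ p ≠ ⊤ := hmin ▸ hfin
  obtain ⟨h1, h1'⟩ := FDB_update hρ hp.1 hp.le_one hpfin z hs hs1
  obtain ⟨h2, h2'⟩ := FDB_update (p := update p z s) hρ
    (fun w => by by_cases h : w = z <;> [simpa [h]; simpa [h] using hp.1 w])
    (fun w => by by_cases h : w = z <;> [simpa [h]; simpa [h] using hp.le_one w]) h1 x ht ht1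
  have hle : FDB γ ρ p ≤ FDB γ ρ (update (update p z s) x t) :=
    hmin ▸ iInf_le (fun p : {p : Zd d → ℝ // IsProb p} => FDB γ ρ p.1) ⟨_, hq⟩
  have hle' := ENNReal.toReal_mono h2 hle
  rw [h2', h1', update_of_ne hzx.symm] at hle'
  have : ((unitSteps d).card : ℝ) * (s - p z) + (unitSteps d).card * (t - p x) = 0 := by
    rw [← mul_add]
    simp [show s - p z + (t - p x) = 0 by linarith]
  linarith

theorem eventually_sitePot_add_sq_le {γ ρ a : ℝ} (ha : 0 < a) (K σ : ℝ) {c : ℝ} (hc : 0 < c) :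
    ∀ᶠ s in 𝓝 (0 : ℝ), K * s ^ 2 + (sitePot γ ρ (a + σ * s ^ 2) - sitePot γ ρ a) ≤ c * |s| := by
  have h1 : HasDerivAt (sitePot γ ρ) (ρ / (1 - γ) * (γ * a ^ (γ - 1) - 1)) a := by
    have : HasDerivAt (fun x => ρ / (1 - γ) * (x ^ γ - x))
        (ρ / (1 - γ) * (γ * a ^ (γ - 1) - 1)) a :=
      ((Real.hasDerivAt_rpow_const (Or.inl ha.ne')).sub (hasDerivAt_id a)).const_mul _
    refine this.congr_of_eventuallyEq ?_
    filter_upwards [eventually_ne_nhds ha.ne'] with x hx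
    simp [sitePot, mpow, hx]
  have hsq : HasDerivAt (fun s : ℝ => s ^ 2) 0 0 := by simpa using hasDerivAt_pow 2 (0 : ℝ)
  have h2 : HasDerivAt (fun s : ℝ => a + σ * s ^ 2) 0 0 := by
    simpa using (hsq.const_mul σ).const_add a
  have h3 : HasDerivAt (fun s : ℝ => sitePot γ ρ (a + σ * s ^ 2)) 0 0 := by
    have h1' : HasDerivAt (sitePot γ ρ) (ρ / (1 - γ) * (γ * a ^ (γ - 1) - 1))
        (a + σ * (0 : ℝ) ^ 2) := by simpa using h1
    simpa [Function.comp_def] using h1'.comp (0 : ℝ) h2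
  have h4 : HasDerivAt (fun s : ℝ => K * s ^ 2 +
      (sitePot γ ρ (a + σ * s ^ 2) - sitePot γ ρ a)) 0 0 := by
    have h := (hsq.const_mul K).add (h3.sub_const (sitePot γ ρ a))
    rw [mul_zero, add_zero] at h
    exact h
  have h5 := (hasDerivAt_iff_isLittleO.1 h4).def hc
  filter_upwards [h5] with s hs
  have := le_trans (le_abs_self _) hs
  simpa using this

theorem tendsto_sqrt_translate {p : Zd d → ℝ} (hp : IsProb p) (e : Zd d) :
    Tendsto (fun z => √(p (z + e))) cofinite (𝓝 0) := by
  have h := hp.2.summable.tendsto_cofinite_zero.comp (add_left_injective e).tendsto_cofinite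
  simpa [Function.comp_def] using (Real.continuous_sqrt.tendsto 0).comp h

/-- For small exponents the potential dominates the square root. -/
theorem le_sitePot {γ ρ : ℝ} (hρ : 0 < ρ) (hγ : γ ≤ 1 / 2) {s : ℝ} (hs : 0 < s) (hs1 : s ≤ 1) :
    ρ / (1 - γ) * (s - s ^ 2) ≤ sitePot γ ρ (s ^ 2) := by
  rw [sitePot, mpow, if_neg (by positivity)]
  refine mul_le_mul_of_nonneg_left (sub_le_sub_right ?_ _)
    (div_nonneg hρ.le (by linarith))
  rw [← Real.rpow_natCast, ← Real.rpow_mul hs.le]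
  simpa using Real.rpow_le_rpow_of_exponent_ge hs hs1
    (show ((2 : ℕ) : ℝ) * γ ≤ 1 by push_cast; linarith)

theorem minimiser_support_finite {γ ρ : ℝ} (hρ : 0 < ρ) (hγ : γ ≤ 1 / 2)
    {p : Zd d → ℝ} (hp : IsProb p)
    (hmin : FDB γ ρ p = chiDB d γ ρ) (hfin : chiDB d γ ρ ≠ ⊤) :
    {z | p z ≠ 0}.Finite := by
  obtain ⟨x, hx⟩ := hp.exists_pos
  set c := ρ / (1 - γ) with hc
  have hc0 : 0 < c := div_pos hρ (by linarith)
  have hsqrt : Tendsto (fun z => √(p z)) cofinite (𝓝 0) := by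
    simpa using tendsto_sqrt_translate hp 0
  have hsum : Tendsto (fun z => ∑ e ∈ unitSteps d, √(p (z + e))) cofinite (𝓝 0) := by
    simpa using tendsto_finsetSum (unitSteps d) fun e _ => tendsto_sqrt_translate hp e
  have hpot := hsqrt.eventually
    (eventually_sitePot_add_sq_le (γ := γ) (ρ := ρ) hx c 1 (show 0 < c / 4 by positivity))
  have hev : ∀ᶠ z in cofinite, p z = 0 := by
    filter_upwards [hpot, hsum.eventually_lt_const (show 0 < c / 4 by positivity),
      (Set.finite_singleton x).compl_mem_cofinite] with z hz1 hz2 hzx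
    by_contra hne
    have hz : 0 < p z := lt_of_le_of_ne (hp.1 z) (Ne.symm hne)
    have hs : 0 < √(p z) := Real.sqrt_pos.2 hz
    have hs1 : √(p z) ≤ 1 := by simpa using hp.le_one z
    have hsq : √(p z) ^ 2 = p z := Real.sq_sqrt hz.le
    have key := transfer_nonneg hρ hp hmin hfin (s := 0) (t := p x + p z) hzx le_rfl
      (by positivity) (by ring)
    have hpz := le_sitePot hρ hγ hs hs1
    rw [hsq] at hpz hz1
    rw [abs_of_pos hs, one_mul] at hz1
    have hmono : 0 ≤ 2 * (√(p x + p z) - √(p x)) *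
        ∑ e ∈ unitSteps d, √(update p z 0 (x + e)) := by
      refine mul_nonneg (mul_nonneg zero_le_two (sub_nonneg.2 (Real.sqrt_le_sqrt (by linarith))))
        (Finset.sum_nonneg fun _ _ => Real.sqrt_nonneg _)
    rw [Real.sqrt_zero, sitePot_zero] at key
    have hlin := mul_lt_mul_of_pos_left hz2 hs
    have hcs : 0 < c * √(p z) := by positivity
    linarith
  simpa [Filter.eventually_cofinite] using hev

/-- A set of lattice points that is stable under unit steps is empty or everything. -/
theorem forall_of_unitSteps {P : Zd d → Prop} (h : ∀ z, ∀ e ∈ unitSteps d, P z → P (z + e))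
    {x : Zd d} (hx : P x) (z : Zd d) : P z := by
  let S : AddSubmonoid (Zd d) :=
    { carrier := {v | ∀ z, P z → P (z + v)}
      zero_mem' := by intro z hz; simpa using hz
      add_mem' := by
        intro a b ha hb z hz
        rw [← add_assoc]
        exact hb _ (ha _ hz) }
  have hunit : ∀ i : Fin d, ∀ ε : ℤ, |ε| = 1 → (Pi.single i ε : Zd d) ∈ S := by
    intro i ε hε z hz
    refine h z _ (mem_unitSteps.2 ?_) hz
    rw [Finset.sum_eq_single i]
    · simpa using hε
    · intro j _ hj; simp [hj]
    · simp
  have hsingle : ∀ i : Fin d, ∀ n : ℤ, (Pi.single i n : Zd d) ∈ S := by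
    intro i n
    induction n using Int.induction_on with
    | zero => simp
    | succ k ih => rw [Pi.single_add]; exact S.add_mem ih (hunit i 1 (by simp))
    | pred k ih =>
      rw [sub_eq_add_neg, Pi.single_add]; exact S.add_mem ih (hunit i (-1) (by simp))
  have hall : z - x ∈ S := by
    rw [← Finset.univ_sum_single (z - x)]
    exact S.sum_mem fun i _ => hsingle i _
  simpa using hall x hx

theorem eventually_sitePot_sq_le {γ ρ : ℝ} (hγ : 1 / 2 < γ) {c : ℝ} (hc : 0 < c) :
    ∀ᶠ s in 𝓝[>] (0 : ℝ), sitePot γ ρ (s ^ 2) ≤ c * s := by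
  have h1 : Tendsto (fun s : ℝ => ρ / (1 - γ) * (s ^ (2 * γ - 1) - s)) (𝓝[>] 0) (𝓝 0) := by
    have h : ContinuousAt (fun s : ℝ => ρ / (1 - γ) * (s ^ (2 * γ - 1) - s)) 0 := by
      refine continuousAt_const.mul (ContinuousAt.sub ?_ continuousAt_id)
      exact Real.continuousAt_rpow_const _ _ (Or.inr (by linarith))
    have h0 : (0 : ℝ) ^ (2 * γ - 1) = 0 := Real.zero_rpow (by linarith)
    have h' := h.tendsto
    simp only [h0, sub_zero, mul_zero] at h'
    exact h'.mono_left nhdsWithin_le_nhds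
  filter_upwards [h1.eventually_le_const hc, self_mem_nhdsWithin] with s hs hs0
  have hs0 : 0 < s := hs0
  rw [sitePot, mpow, if_neg (by positivity), ← Real.rpow_natCast, ← Real.rpow_mul hs0.le]
  have h2 : s ^ (((2 : ℕ) : ℝ) * γ) = s ^ (2 * γ - 1) * s := by
    rw [← Real.rpow_add_one hs0.ne']; push_cast; ring_nf
  have h3 : s ^ ((2 : ℕ) : ℝ) = s * s := by rw [Real.rpow_natCast, sq]
  rw [h2, h3]
  nlinarith [mul_le_mul_of_nonneg_right hs hs0.le]

theorem minimiser_pos {γ ρ : ℝ} (hρ : 0 < ρ) (hγ : 1 / 2 < γ)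
    {p : Zd d → ℝ} (hp : IsProb p)
    (hmin : FDB γ ρ p = chiDB d γ ρ) (hfin : chiDB d γ ρ ≠ ⊤) (z : Zd d) : 0 < p z := by
  obtain ⟨x₀, hx₀⟩ := hp.exists_pos
  refine forall_of_unitSteps (P := fun z => 0 < p z) (fun x e he hx => ?_) hx₀ z
  by_contra hne
  have hz : p (x + e) = 0 := le_antisymm (not_lt.1 hne) (hp.1 _)
  have hzx : x + e ≠ x := fun h => by rw [h] at hz; exact hx.ne' hz
  set N : ℝ := ((unitSteps d).card : ℝ) with hN
  set r := √(p x) with hr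
  have hr0 : 0 < r := Real.sqrt_pos.2 hx
  have hrsq : r ^ 2 = p x := Real.sq_sqrt hx.le
  have h1 := eventually_sitePot_sq_le (ρ := ρ) hγ (show 0 < r / 2 by positivity)
  have h2 := (eventually_sitePot_add_sq_le (γ := γ) (ρ := ρ) hx (2 * N / r) (-1)
    (show 0 < r / 2 by positivity)).filter_mono (nhdsWithin_le_nhds (s := Set.Ioi 0))
  have h3 : ∀ᶠ s in 𝓝[>] (0 : ℝ), s < min r 1 :=
    (eventually_lt_nhds (by positivity)).filter_mono nhdsWithin_le_nhds
  obtain ⟨s, hs1, hs2, hs3, hs0⟩ := (h1.and (h2.and (h3.and self_mem_nhdsWithin))).exists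
  have hs0 : 0 < s := hs0
  have hsr : s < r := hs3.trans_le (min_le_left _ _)
  have hs1' : s < 1 := hs3.trans_le (min_le_right _ _)
  have hts : 0 ≤ p x + -1 * s ^ 2 := by nlinarith
  have key := transfer_nonneg hρ hp hmin hfin hzx (s := s ^ 2) (t := p x + -1 * s ^ 2)
    (sq_nonneg s) hts (by rw [hz]; ring)
  rw [hz, Real.sqrt_zero, sub_zero, sitePot_zero, sub_zero, Real.sqrt_sq hs0.le, ← hr] at key
  rw [abs_of_pos hs0] at hs2
  have hsum1 : r ≤ ∑ e' ∈ unitSteps d, √(p (x + e + e')) := by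
    have hmem : -e ∈ unitSteps d := by
      rw [mem_unitSteps] at he ⊢
      simpa using he
    have := Finset.single_le_sum (f := fun e' => √(p (x + e + e')))
      (fun _ _ => Real.sqrt_nonneg _) hmem
    simpa [hr] using this
  have hsum2 : ∑ e' ∈ unitSteps d, √(update p (x + e) (s ^ 2) (x + e')) ≤ N := by
    rw [hN, ← nsmul_one, ← Finset.sum_const]
    refine Finset.sum_le_sum fun e' _ => ?_
    rw [Real.sqrt_le_one]
    by_cases h : x + e' = x + e
    · rw [h, update_self]; nlinarith
    · rw [update_of_ne h]; exact hp.le_one _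
  set A := ∑ e' ∈ unitSteps d, √(p (x + e + e'))
  set B := ∑ e' ∈ unitSteps d, √(update p (x + e) (s ^ 2) (x + e'))
  set τ := √(p x + -1 * s ^ 2)
  have hτsq : τ ^ 2 = p x + -1 * s ^ 2 := Real.sq_sqrt hts
  have hτ0 : 0 ≤ τ := Real.sqrt_nonneg _
  have hN0 : 0 ≤ N := by positivity
  have hτr : τ ≤ r := by nlinarith
  have hdiff : r - τ ≤ s ^ 2 / r := by
    rw [le_div_iff₀ hr0]
    nlinarith
  have hB : (r - τ) * B ≤ s ^ 2 / r * N :=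
    (mul_le_mul_of_nonneg_left hsum2 (sub_nonneg.2 hτr)).trans
      (mul_le_mul_of_nonneg_right hdiff hN0)
  have hA : s * r ≤ s * A := mul_le_mul_of_nonneg_left hsum1 hs0.le
  have hrw : 2 * N / r * s ^ 2 = 2 * (s ^ 2 / r * N) := by ring
  rw [hrw] at hs2
  have hsr0 : 0 < s * r := by positivity
  linarith

end LatticeEnergy

/-- Support properties of minimisers of `χ^{DB}_γ(ρ)`. -/
theorem stmt4 (d : ℕ) (hd : 1 ≤ d) (ρ γ : ℝ) (hρ : 0 < ρ) (hγ0 : 0 ≤ γ) (hγ1 : γ ≠ 1)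
    (hγ : γ < max (1 + 1 / (d:ℝ)) (1 + ρ / (2 * d)))
    (p : Zd d → ℝ) (hp : IsProb p)
    (hmin : FDB γ ρ p = chiDB d γ ρ) (hfin : chiDB d γ ρ ≠ ⊤) :
    ({z | p z ≠ 0}.Finite ↔ γ ≤ 1 / 2) ∧ (1 / 2 < γ → ∀ z, 0 < p z) := by
  refine ⟨⟨fun h => ?_, fun h => minimiser_support_finite hρ h hp hmin hfin⟩,
    fun h => minimiser_pos hρ h hp hmin hfin⟩
  by_contra! hlt
  have hpos := minimiser_pos hρ hlt hp hmin hfin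
  have huniv : {z | p z ≠ 0} = Set.univ := Set.eq_univ_of_forall fun z => (hpos z).ne'
  rw [huniv] at h
  have : Nonempty (Fin d) := ⟨⟨0, hd⟩⟩
  exact Set.infinite_univ h
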